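/- arXiv:2110.09368 — 5 statements merged into one kernel-verified Lean document; each statement's English description precedes it below -/
import Mathlib

section
/- For every real Δ > 0 and every complex s with Re(s) > 1, one has (Δ/π)^s Γ(s) ζ⁽²⁾(s,Δ) = (1/2) ∫₀^∞ t^{s−1} (θ₃(e^{−πtΔ}) θ₃(e^{−πt/Δ}) − 1) dt, where Γ is the Gamma function. -/
open MeasureTheory

/-- The Jacobi theta function `θ₃(q) = Σ_{j∈ℤ} q^{j²}`. -/
noncomputable def theta3 (q : ℝ) : ℝ := ∑' j : ℤ, q ^ (j ^ 2)

/-- The two-dimensional Epstein zeta function on the rectangular lattice with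
spacings `1` and `Δ`:  `ζ⁽²⁾(s,Δ) = (1/2) Σ'_{(j,k)≠(0,0)} (j² + Δ²k²)^(-s)`. -/
noncomputable def epsteinZeta2 (s : ℂ) (Δ : ℝ) : ℂ :=
  (1 / 2) * ∑' p : {p : ℤ × ℤ // p ≠ 0},
    (((p.1.1 : ℝ) ^ 2 + Δ ^ 2 * (p.1.2 : ℝ) ^ 2 : ℝ) : ℂ) ^ (-s)

/-- The Gaussian sum over the integers converges. -/
theorem summable_exp_neg_pi_mul_int_sq {c : ℝ} (hc : 0 < c) :
    Summable fun j : ℤ ↦ Real.exp (-(Real.pi * c)) ^ (j ^ 2) := by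
  have h := ((summable_jacobiTheta₂_term_iff 0 (Complex.I * c)).2 (by simpa using hc)).norm
  refine h.congr fun j ↦ ?_
  rw [norm_jacobiTheta₂_term, ← Real.rpow_intCast, ← Real.exp_mul]
  congr 1
  simp
  ring

/-- A positive definite diagonal binary quadratic form dominates the square of the sup norm. -/
theorem min_mul_norm_sq_le {a b : ℝ} (ha : 0 < a) (hb : 0 < b) (x : Fin 2 → ℤ) :
    min a b * ‖x‖ ^ 2 ≤ a * (x 0 : ℝ) ^ 2 + b * (x 1 : ℝ) ^ 2 := by
  have hle : ‖x‖ ^ 2 ≤ (x 0 : ℝ) ^ 2 + (x 1 : ℝ) ^ 2 := by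
    have h : ‖x‖ ≤ √((x 0 : ℝ) ^ 2 + (x 1 : ℝ) ^ 2) := by
      refine (pi_norm_le_iff_of_nonneg (Real.sqrt_nonneg _)).2 fun i ↦ Real.le_sqrt_of_sq_le ?_
      fin_cases i <;> simp [Int.norm_eq_abs, sq_abs] <;> positivity
    exact (Real.le_sqrt (norm_nonneg _) (by positivity)).1 h
  have h1 := min_le_left a b
  have h2 := min_le_right a b
  have h0 : 0 < min a b := lt_min ha hb
  nlinarith [mul_le_mul_of_nonneg_left hle h0.le,
    mul_le_mul_of_nonneg_right h1 (sq_nonneg (x 0 : ℝ)),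
    mul_le_mul_of_nonneg_right h2 (sq_nonneg (x 1 : ℝ))]

/-- The Epstein zeta series of a positive definite diagonal binary form converges for `σ > 1`. -/
theorem summable_one_div_diagonal_form_rpow {a b σ : ℝ} (ha : 0 < a) (hb : 0 < b) (hσ : 1 < σ) :
    Summable fun p : {p : ℤ × ℤ // p ≠ 0} ↦
      1 / (a * (p.1.1 : ℝ) ^ 2 + b * (p.1.2 : ℝ) ^ 2) ^ σ := by
  have h := (EisensteinSeries.summable_one_div_norm_rpow (k := 2 * σ) (by linarith)).mul_left
    ((min a b) ^ (-σ))
  have h' := (h.comp_injective (finTwoArrowEquiv ℤ).symm.injective).comp_injective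
    (Subtype.val_injective (p := fun p : ℤ × ℤ ↦ p ≠ 0))
  refine h'.of_nonneg_of_le (fun p ↦ by positivity) fun p ↦ ?_
  have hx : (finTwoArrowEquiv ℤ).symm p.1 ≠ 0 := fun h0 ↦ p.2 <| by
    have e0 := congrFun h0 0
    have e1 := congrFun h0 1
    ext
    · simpa using e0
    · simpa using e1
  have hm := min_mul_norm_sq_le ha hb ((finTwoArrowEquiv ℤ).symm p.1)
  have hn : 0 < ‖(finTwoArrowEquiv ℤ).symm p.1‖ := norm_pos_iff.2 hx
  have h0 : 0 < min a b := lt_min ha hb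
  have hmul : (min a b * ‖(finTwoArrowEquiv ℤ).symm p.1‖ ^ 2) ^ (-σ)
      = (min a b) ^ (-σ) * ‖(finTwoArrowEquiv ℤ).symm p.1‖ ^ (-(2 * σ)) := by
    rw [Real.mul_rpow h0.le (by positivity), ← Real.rpow_natCast, ← Real.rpow_mul hn.le]
    congr 2
    push_cast
    ring
  have hle := Real.rpow_le_rpow_of_nonpos (z := -σ) (by positivity) hm (by linarith)
  rw [hmul] at hle
  have hpos : 0 < a * (p.1.1 : ℝ) ^ 2 + b * (p.1.2 : ℝ) ^ 2 := by
    have := (mul_pos h0 (pow_pos hn 2)).trans_le hm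
    simpa using this
  rw [one_div, ← Real.rpow_neg hpos.le]
  simpa using hle

/-- The product of two theta functions, minus its constant term, as a sum over nonzero lattice
points. -/
theorem hasSum_theta3_mul_theta3_sub_one {a b : ℝ} (ha : 0 < a) (hb : 0 < b) :
    HasSum (fun p : {p : ℤ × ℤ // p ≠ 0} ↦
      Real.exp (-Real.pi * (a * (p.1.1 : ℝ) ^ 2 + b * (p.1.2 : ℝ) ^ 2)))
      (theta3 (Real.exp (-(Real.pi * b))) * theta3 (Real.exp (-(Real.pi * a))) - 1) := by
  have h1 := summable_exp_neg_pi_mul_int_sq ha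
  have h2 := summable_exp_neg_pi_mul_int_sq hb
  have hprod := h1.hasSum.mul h2.hasSum
    (h1.mul_of_nonneg h2 (fun _ ↦ by positivity) (fun _ ↦ by positivity))
  have hfun : (fun x : ℤ × ℤ ↦ Real.exp (-(Real.pi * a)) ^ (x.1 ^ 2) *
      Real.exp (-(Real.pi * b)) ^ (x.2 ^ 2)) = fun x : ℤ × ℤ ↦
      Real.exp (-Real.pi * (a * (x.1 : ℝ) ^ 2 + b * (x.2 : ℝ) ^ 2)) := by
    funext x
    rw [← Real.rpow_intCast, ← Real.rpow_intCast, ← Real.exp_mul, ← Real.exp_mul, ← Real.exp_add]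
    congr 1
    push_cast
    ring
  rw [hfun] at hprod
  have hz := hasSum_ite_sub_hasSum hprod (0 : ℤ × ℤ)
  have hinj : Function.Injective (Subtype.val : {p : ℤ × ℤ // p ≠ 0} → ℤ × ℤ) :=
    Subtype.val_injective
  rw [← hinj.hasSum_iff] at hz
  · have hval : (∑' j : ℤ, Real.exp (-(Real.pi * a)) ^ (j ^ 2)) *
        (∑' j : ℤ, Real.exp (-(Real.pi * b)) ^ (j ^ 2)) -
        Real.exp (-Real.pi * (a * ((0 : ℤ × ℤ).1 : ℝ) ^ 2 + b * ((0 : ℤ × ℤ).2 : ℝ) ^ 2)) =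
        theta3 (Real.exp (-(Real.pi * b))) * theta3 (Real.exp (-(Real.pi * a))) - 1 := by
      rw [theta3, theta3, mul_comm]
      simp
    rw [hval] at hz
    refine hz.congr_fun fun p ↦ ?_
    rw [Function.comp_apply, if_neg p.2]
  · intro x hx
    have : x = 0 := by simpa using hx
    rw [if_pos this]

/-- for `Δ > 0` and `Re s > 1`,
`(Δ/π)^s Γ(s) ζ⁽²⁾(s,Δ) = (1/2) ∫₀^∞ t^{s-1} (θ₃(e^{-πtΔ}) θ₃(e^{-πt/Δ}) - 1) dt`. -/
theorem epstein_gamma_integral_rep (Δ : ℝ) (hΔ : 0 < Δ) (s : ℂ) (hs : 1 < s.re) :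
    ((Δ / Real.pi : ℝ) : ℂ) ^ s * Complex.Gamma s * epsteinZeta2 s Δ =
      (1 / 2) * ∫ t in Set.Ioi (0 : ℝ),
        (t : ℂ) ^ (s - 1) *
          ((theta3 (Real.exp (-(Real.pi * t * Δ))) *
              theta3 (Real.exp (-(Real.pi * t / Δ))) - 1 : ℝ) : ℂ) := by
  have hpos (p : {p : ℤ × ℤ // p ≠ 0}) : 0 < (p.1.1 : ℝ) ^ 2 + Δ ^ 2 * (p.1.2 : ℝ) ^ 2 := by
    obtain ⟨⟨j, k⟩, hp⟩ := p
    by_cases hj : j = 0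
    · have hk : (k : ℝ) ≠ 0 := by
        rintro hk
        exact hp (by simp [hj, Int.cast_eq_zero.1 hk])
      simp only
      positivity
    · have hj' : (j : ℝ) ≠ 0 := Int.cast_ne_zero.2 hj
      simp only
      positivity
  have hform (p : {p : ℤ × ℤ // p ≠ 0}) : Δ⁻¹ * (p.1.1 : ℝ) ^ 2 + Δ * (p.1.2 : ℝ) ^ 2
      = Δ⁻¹ * ((p.1.1 : ℝ) ^ 2 + Δ ^ 2 * (p.1.2 : ℝ) ^ 2) := by
    field_simp
  have key := hasSum_mellin_pi_mul (s := s) (a := fun _ : {p : ℤ × ℤ // p ≠ 0} ↦ 1)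
    (q := fun p ↦ Δ⁻¹ * (p.1.1 : ℝ) ^ 2 + Δ * (p.1.2 : ℝ) ^ 2)
    (F := fun t ↦ ((theta3 (Real.exp (-(Real.pi * t * Δ))) *
      theta3 (Real.exp (-(Real.pi * t / Δ))) - 1 : ℝ) : ℂ))
    (fun p ↦ Or.inr (by
      rw [hform]
      exact mul_pos (inv_pos.2 hΔ) (hpos p)))
    (by linarith)
    (fun t ht ↦ by
      have ht' : 0 < t := ht
      have h := hasSum_theta3_mul_theta3_sub_one (a := t * Δ⁻¹) (b := t * Δ)
        (by positivity) (by positivity)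
      convert Complex.hasSum_ofReal.2 h using 1
      · funext p
        rw [one_mul]
        congr 2
        ring
      · simp only [mul_assoc, div_eq_mul_inv])
    (by simpa using summable_one_div_diagonal_form_rpow (inv_pos.2 hΔ) hΔ hs)
  have hmellin := key.tsum_eq
  simp only [mellin, smul_eq_mul] at hmellin
  rw [← hmellin, epsteinZeta2, mul_left_comm, ← tsum_mul_left]
  congr 1
  refine tsum_congr fun p ↦ ?_
  rw [hform, mul_one, div_eq_mul_inv, div_eq_mul_inv, Complex.ofReal_mul, Complex.ofReal_mul,
    Complex.mul_cpow_ofReal_nonneg hΔ.le (by positivity),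
    Complex.mul_cpow_ofReal_nonneg (by positivity) (hpos p).le, Complex.cpow_neg,
    Complex.cpow_neg, Complex.ofReal_inv, Complex.ofReal_inv, Complex.inv_cpow, Complex.inv_cpow,
    mul_inv, inv_inv]
  · ring
  · rw [Complex.arg_ofReal_of_nonneg hΔ.le]
    exact Real.pi_pos.ne
  · rw [Complex.arg_ofReal_of_nonneg Real.pi_pos.le]
    exact Real.pi_pos.ne
end

section
/- For every real Δ > 0 and every complex s, ∫₁^∞ t^{s−1} (θ₃(e^{−πtΔ}) θ₃(e^{−πt/Δ}) − 1) dt = ∫₀¹ t^{−s} (θ₃(e^{−πtΔ}) θ₃(e^{−πt/Δ}) − 1/t) dt, both integrals being absolutely convergent. -/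
open MeasureTheory

open Filter Asymptotics HurwitzZeta

lemma theta3_exp_neg_pi_mul {x : ℝ} (hx : 0 < x) :
    theta3 (Real.exp (-(Real.pi * x))) = evenKernel 0 x := by
  have h := (hasSum_int_evenKernel 0 hx).tsum_eq
  rw [QuotientAddGroup.mk_zero] at h
  rw [← h, theta3]
  refine tsum_congr fun n => ?_
  rw [← Real.rpow_intCast, ← Real.exp_mul]
  push_cast
  ring_nf

lemma evenKernel_zero_functional_equation {x : ℝ} (hx : 0 < x) :
    evenKernel 0 x⁻¹ = √x * evenKernel 0 x := by
  rw [evenKernel_functional_equation, ← evenKernel_eq_cosKernel_of_zero, one_div x⁻¹, inv_inv,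
    Real.inv_rpow hx.le, one_div, inv_inv, Real.sqrt_eq_rpow]

lemma isBigO_evenKernel_zero_mul_sub_one {c : ℝ} (hc : 0 < c) (r : ℝ) :
    (fun t => evenKernel 0 (t * c) - 1) =O[atTop] (fun t : ℝ => t ^ r) := by
  obtain ⟨p, hp, h⟩ := isBigO_atTop_evenKernel_sub 0
  simp only [if_true] at h
  have h1 := (h.trans (isLittleO_exp_neg_mul_rpow_atTop hp r).isBigO).comp_tendsto
    (tendsto_id.atTop_mul_const hc)
  refine h1.trans (IsBigO.of_bound (c ^ r) ?_)
  filter_upwards [eventually_gt_atTop 0] with t ht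
  have := Real.rpow_nonneg hc.le r
  simp [Real.mul_rpow ht.le hc.le, abs_of_nonneg this, mul_comm (c ^ r)]

/-- The theta product `θ₃(e^{-πtΔ}) θ₃(e^{-πt/Δ})`, as a product of even kernels. -/
noncomputable def thetaProd (Δ t : ℝ) : ℝ := evenKernel 0 (t * Δ) * evenKernel 0 (t * Δ⁻¹)

lemma theta3_mul_theta3 {Δ t : ℝ} (hΔ : 0 < Δ) (ht : 0 < t) :
    theta3 (Real.exp (-(Real.pi * t * Δ))) * theta3 (Real.exp (-(Real.pi * t / Δ))) =
      thetaProd Δ t := by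
  rw [thetaProd, ← theta3_exp_neg_pi_mul (by positivity), ← theta3_exp_neg_pi_mul (by positivity),
    mul_assoc, ← mul_assoc Real.pi t Δ⁻¹, ← div_eq_mul_inv]

lemma thetaProd_inv {Δ t : ℝ} (hΔ : 0 < Δ) (ht : 0 < t) :
    thetaProd Δ t⁻¹ = t * thetaProd Δ t := by
  have h1 : t⁻¹ * Δ = (t * Δ⁻¹)⁻¹ := by simp [mul_comm]
  rw [thetaProd, thetaProd, ← mul_inv, h1, evenKernel_zero_functional_equation (by positivity),
    evenKernel_zero_functional_equation (by positivity)]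
  have h2 : √(t * Δ⁻¹) * √(t * Δ) = t := by
    rw [← Real.sqrt_mul (by positivity), show t * Δ⁻¹ * (t * Δ) = t ^ 2 by field_simp,
      Real.sqrt_sq ht.le]
  linear_combination (evenKernel 0 (t * Δ⁻¹) * evenKernel 0 (t * Δ)) * h2

lemma continuousOn_thetaProd {Δ : ℝ} (hΔ : 0 < Δ) : ContinuousOn (thetaProd Δ) (Set.Ioi 0) :=
  ((continuousOn_evenKernel 0).comp (by fun_prop) fun _ ht => mul_pos ht hΔ).mul
    ((continuousOn_evenKernel 0).comp (by fun_prop) fun _ ht => mul_pos ht (inv_pos.2 hΔ))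

lemma isBigO_thetaProd_sub_one {Δ : ℝ} (hΔ : 0 < Δ) (r : ℝ) :
    (fun t => thetaProd Δ t - 1) =O[atTop] (fun t : ℝ => t ^ r) := by
  have hA := isBigO_evenKernel_zero_mul_sub_one hΔ
  have hB := isBigO_evenKernel_zero_mul_sub_one (inv_pos.2 hΔ)
  have h := (hA r).mul (hB 0)
  simp only [Real.rpow_zero, mul_one] at h
  refine ((h.add (hA r)).add (hB r)).congr_left fun t => ?_
  rw [thetaProd]
  ring

lemma integrableOn_cpow_mul_thetaProd_sub_one {Δ : ℝ} (hΔ : 0 < Δ) (s : ℂ) :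
    IntegrableOn (fun t : ℝ => (t : ℂ) ^ (s - 1) * ((thetaProd Δ t - 1 : ℝ) : ℂ))
      (Set.Ioi 1) := by
  have hc : ContinuousOn (fun t : ℝ => (t : ℂ) ^ (s - 1) * ((thetaProd Δ t - 1 : ℝ) : ℂ))
      (Set.Ici 1) := by
    have hpos : ∀ t ∈ Set.Ici (1 : ℝ), 0 < t := fun t ht => zero_lt_one.trans_le ht
    refine ContinuousOn.mul (fun t ht => ?_) ?_
    · exact (Complex.continuousAt_ofReal_cpow_const t (s - 1)
        (Or.inr (hpos t ht).ne')).continuousWithinAt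
    · exact Complex.continuous_ofReal.comp_continuousOn
        (((continuousOn_thetaProd hΔ).mono hpos).sub continuousOn_const)
  rw [← integrableOn_Ici_iff_integrableOn_Ioi]
  refine (hc.locallyIntegrableOn measurableSet_Ici).integrableOn_of_isBigO_atTop
    (g := fun t : ℝ => t ^ (-2 : ℝ)) ?_
    ⟨Set.Ioi 1, Ioi_mem_atTop 1, integrableOn_Ioi_rpow_of_lt (by norm_num) zero_lt_one⟩
  have h1 : (fun t : ℝ => (t : ℂ) ^ (s - 1)) =O[atTop] (fun t : ℝ => t ^ (s - 1).re) := by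
    refine IsBigO.of_bound 1 ?_
    filter_upwards [eventually_gt_atTop 0] with t ht
    rw [Complex.norm_cpow_eq_rpow_re_of_pos ht, one_mul]
    exact le_abs_self _
  refine (h1.mul (Complex.isBigO_ofReal_left.2
    (isBigO_thetaProd_sub_one hΔ (-2 - (s - 1).re)))).congr' .rfl ?_
  filter_upwards [eventually_gt_atTop 0] with t ht
  rw [← Real.rpow_add ht]
  ring_nf

lemma image_inv_Ioi_one : (fun t : ℝ => t⁻¹) '' Set.Ioi 1 = Set.Ioo 0 1 := by
  rw [Set.image_inv_eq_inv, Set.inv_Ioi₀ zero_lt_one, inv_one]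

lemma abs_deriv_inv_smul_reflected {Δ t : ℝ} (hΔ : 0 < Δ) (ht : 0 < t) (s : ℂ) :
    |-(t ^ 2)⁻¹| • (((t⁻¹ : ℝ) : ℂ) ^ (-s) * ((thetaProd Δ t⁻¹ - 1 / t⁻¹ : ℝ) : ℂ)) =
      (t : ℂ) ^ (s - 1) * ((thetaProd Δ t - 1 : ℝ) : ℂ) := by
  have ht' : (t : ℂ) ≠ 0 := Complex.ofReal_ne_zero.2 ht.ne'
  have harg : (t : ℂ).arg ≠ Real.pi := by
    rw [Complex.arg_ofReal_of_nonneg ht.le]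
    exact Real.pi_ne_zero.symm
  rw [thetaProd_inv hΔ ht, abs_neg, abs_of_pos (by positivity), Complex.real_smul,
    Complex.ofReal_inv t, Complex.inv_cpow _ _ harg, Complex.cpow_neg, inv_inv,
    Complex.cpow_sub _ _ ht', Complex.cpow_one]
  push_cast
  field_simp

/-- for `Δ > 0` and any complex `s`,
`∫₁^∞ t^{s-1} (θ₃(e^{-πtΔ}) θ₃(e^{-πt/Δ}) - 1) dt
  = ∫₀¹ t^{-s} (θ₃(e^{-πtΔ}) θ₃(e^{-πt/Δ}) - 1/t) dt`,
both integrals being absolutely convergent (Bochner integrable). -/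
theorem theta_integral_reflection (Δ : ℝ) (hΔ : 0 < Δ) (s : ℂ) :
    IntegrableOn (fun t : ℝ =>
        (t : ℂ) ^ (s - 1) *
          ((theta3 (Real.exp (-(Real.pi * t * Δ))) *
              theta3 (Real.exp (-(Real.pi * t / Δ))) - 1 : ℝ) : ℂ)) (Set.Ioi 1) ∧
    IntegrableOn (fun t : ℝ =>
        (t : ℂ) ^ (-s) *
          ((theta3 (Real.exp (-(Real.pi * t * Δ))) *
              theta3 (Real.exp (-(Real.pi * t / Δ))) - 1 / t : ℝ) : ℂ)) (Set.Ioo 0 1) ∧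
    (∫ t in Set.Ioi (1 : ℝ),
        (t : ℂ) ^ (s - 1) *
          ((theta3 (Real.exp (-(Real.pi * t * Δ))) *
              theta3 (Real.exp (-(Real.pi * t / Δ))) - 1 : ℝ) : ℂ)) =
      ∫ t in Set.Ioo (0 : ℝ) 1,
        (t : ℂ) ^ (-s) *
          ((theta3 (Real.exp (-(Real.pi * t * Δ))) *
              theta3 (Real.exp (-(Real.pi * t / Δ))) - 1 / t : ℝ) : ℂ) := by
  have hF : Set.EqOn (fun t : ℝ => (t : ℂ) ^ (s - 1) *
      ((theta3 (Real.exp (-(Real.pi * t * Δ))) *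
        theta3 (Real.exp (-(Real.pi * t / Δ))) - 1 : ℝ) : ℂ))
      (fun t : ℝ => (t : ℂ) ^ (s - 1) * ((thetaProd Δ t - 1 : ℝ) : ℂ)) (Set.Ioi 1) := fun t ht => by
    simp only [theta3_mul_theta3 hΔ (zero_lt_one.trans ht)]
  have hG : Set.EqOn (fun t : ℝ => (t : ℂ) ^ (-s) *
      ((theta3 (Real.exp (-(Real.pi * t * Δ))) *
        theta3 (Real.exp (-(Real.pi * t / Δ))) - 1 / t : ℝ) : ℂ))
      (fun t : ℝ => (t : ℂ) ^ (-s) * ((thetaProd Δ t - 1 / t : ℝ) : ℂ)) (Set.Ioo 0 1) :=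
    fun t ht => by simp only [theta3_mul_theta3 hΔ ht.1]
  rw [integrableOn_congr_fun hF measurableSet_Ioi, integrableOn_congr_fun hG measurableSet_Ioo,
    setIntegral_congr_fun measurableSet_Ioi hF, setIntegral_congr_fun measurableSet_Ioo hG]
  have hderiv : ∀ t ∈ Set.Ioi (1 : ℝ),
      HasDerivWithinAt (fun t : ℝ => t⁻¹) (-(t ^ 2)⁻¹) (Set.Ioi 1) t := fun t ht =>
    (hasDerivAt_inv (zero_lt_one.trans ht).ne').hasDerivWithinAt
  have hinj : Set.InjOn (fun t : ℝ => t⁻¹) (Set.Ioi 1) := inv_injective.injOn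
  have hcongr : Set.EqOn
      (fun t : ℝ => |-(t ^ 2)⁻¹| •
        (((t⁻¹ : ℝ) : ℂ) ^ (-s) * ((thetaProd Δ t⁻¹ - 1 / t⁻¹ : ℝ) : ℂ)))
      (fun t : ℝ => (t : ℂ) ^ (s - 1) * ((thetaProd Δ t - 1 : ℝ) : ℂ)) (Set.Ioi 1) :=
    fun t ht => abs_deriv_inv_smul_reflected hΔ (zero_lt_one.trans ht) s
  have hint := integrableOn_cpow_mul_thetaProd_sub_one hΔ s
  rw [← image_inv_Ioi_one]
  refine ⟨hint, ?_, ?_⟩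
  · rw [integrableOn_image_iff_integrableOn_abs_deriv_smul measurableSet_Ioi hderiv hinj]
    exact (integrableOn_congr_fun hcongr measurableSet_Ioi).2 hint
  · rw [integral_image_eq_integral_abs_deriv_smul measurableSet_Ioi hderiv hinj]
    exact (setIntegral_congr_fun measurableSet_Ioi hcongr).symm
end

section
/- For every real Δ > 0, the analytic continuation of the Epstein zeta function takes the value −1/2 at s = 0; precisely, the limit as s → 0 (s ≠ 0) of s · (π/Δ)^s · F(s,Δ) equals −1/2 (equivalently, lim_{s→0} (π/Δ)^s F(s,Δ)/Γ(s) = −1/2, since Γ(s) ∼ 1/s as s → 0). -/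
open MeasureTheory

/-- The analytic continuation
`F(s,Δ) = -(1/2)(1/(1-s) + 1/s)
   + (1/2)∫₀¹ (t^{s-1} + t^{-s}) (θ₃(e^{-πtΔ}) θ₃(e^{-πt/Δ}) - 1/t) dt`. -/
noncomputable def F (s : ℂ) (Δ : ℝ) : ℂ :=
  -(1 / 2) * (1 / (1 - s) + 1 / s) +
    (1 / 2) * ∫ t in Set.Ioo (0 : ℝ) 1,
      ((t : ℂ) ^ (s - 1) + (t : ℂ) ^ (-s)) *
        ((theta3 (Real.exp (-(Real.pi * t * Δ))) *
            theta3 (Real.exp (-(Real.pi * t / Δ))) - 1 / t : ℝ) : ℂ)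

open Filter Topology in
/-- A function of `s` that is bounded near `0` vanishes at `0` after multiplication by `s`. -/
theorem tendsto_self_mul_of_norm_le {f : ℂ → ℂ} {K : ℝ} (hf : ∀ᶠ s in 𝓝[≠] 0, ‖f s‖ ≤ K) :
    Tendsto (fun s : ℂ => s * f s) (𝓝[≠] 0) (𝓝 0) := by
  have h : Tendsto (fun s : ℂ => s) (𝓝[≠] 0) (𝓝 0) := tendsto_id.mono_left nhdsWithin_le_nhds
  exact h.zero_mul_isBoundedUnder_le ⟨K, by simpa using hf⟩

theorem theta3_exp_eq (a : ℝ) :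
    theta3 (Real.exp (-(Real.pi * a))) = ∑' n : ℤ, Real.exp (-Real.pi * a * (n : ℝ) ^ 2) := by
  refine tsum_congr fun n => ?_
  rw [← Real.rpow_intCast, ← Real.exp_mul]
  push_cast
  ring_nf

/-- The modular transformation of `θ₃`. -/
theorem theta3_exp_inv {a : ℝ} (ha : 0 < a) :
    theta3 (Real.exp (-(Real.pi * a))) =
      1 / Real.sqrt a * theta3 (Real.exp (-(Real.pi * a⁻¹))) := by
  rw [theta3_exp_eq, theta3_exp_eq, Real.tsum_exp_neg_mul_int_sq ha, Real.sqrt_eq_rpow]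
  simp only [div_eq_mul_inv]

theorem Real.exp_neg_le_two_div_sq {x : ℝ} (hx : 0 < x) : Real.exp (-x) ≤ 2 / x ^ 2 := by
  have h := Real.quadratic_le_exp_of_nonneg hx.le
  rw [Real.exp_neg, inv_le_comm₀ (Real.exp_pos x) (by positivity), inv_div]
  linarith

theorem abs_theta3_exp_sub_one_le {y : ℝ} (hy : 0 < y) :
    |theta3 (Real.exp (-(Real.pi * y))) - 1| ≤ (∑' n : ℤ, 1 / (n : ℝ) ^ 4) * 2 / y ^ 2 := by
  have hs : Summable fun n : ℤ => 1 / (n : ℝ) ^ 4 :=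
    Real.summable_one_div_int_pow.mpr (by norm_num)
  have hg : Summable fun n : ℤ => 1 / (n : ℝ) ^ 4 * (2 / y ^ 2) := hs.mul_right _
  have hle (n : ℤ) (hn : n ≠ 0) :
      Real.exp (-Real.pi * y * (n : ℝ) ^ 2) ≤ 1 / (n : ℝ) ^ 4 * (2 / y ^ 2) := by
    have hn' : (0 : ℝ) < (n : ℝ) ^ 2 := by positivity
    calc Real.exp (-Real.pi * y * (n : ℝ) ^ 2) ≤ Real.exp (-(y * (n : ℝ) ^ 2)) := by
          apply Real.exp_le_exp.mpr
          nlinarith [Real.pi_gt_three, mul_pos hy hn']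
      _ ≤ 2 / (y * (n : ℝ) ^ 2) ^ 2 := Real.exp_neg_le_two_div_sq (by positivity)
      _ = 1 / (n : ℝ) ^ 4 * (2 / y ^ 2) := by field_simp
  let f : ℤ → ℝ := fun n => if n = 0 then 0 else Real.exp (-Real.pi * y * (n : ℝ) ^ 2)
  have hf0 (n : ℤ) : 0 ≤ f n := by
    dsimp only [f]; split_ifs <;> positivity
  have hfg (n : ℤ) : f n ≤ 1 / (n : ℝ) ^ 4 * (2 / y ^ 2) := by
    dsimp only [f]; split_ifs with h
    · positivity
    · exact hle n h
  have hf : Summable f := hg.of_nonneg_of_le hf0 hfg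
  have hsplit : theta3 (Real.exp (-(Real.pi * y))) = 1 + ∑' n, f n := by
    have h1 := (hasSum_ite_eq (0 : ℤ) (1 : ℝ)).add hf.hasSum
    rw [theta3_exp_eq, ← h1.tsum_eq]
    refine tsum_congr fun n => ?_
    by_cases h : n = 0 <;> simp [f, h]
  rw [hsplit, add_sub_cancel_left, abs_of_nonneg (tsum_nonneg hf0), mul_div_assoc, ← tsum_mul_right]
  exact hf.tsum_le_tsum hfg hg

theorem exists_abs_theta3_mul_theta3_sub_le {Δ : ℝ} (hΔ : 0 < Δ) :
    ∃ K : ℝ, ∀ t ∈ Set.Ioo (0 : ℝ) 1,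
      |theta3 (Real.exp (-(Real.pi * t * Δ))) * theta3 (Real.exp (-(Real.pi * t / Δ))) - 1 / t|
        ≤ K * t := by
  set C : ℝ := (∑' n : ℤ, 1 / (n : ℝ) ^ 4) * 2
  have hC : 0 ≤ C := mul_nonneg (tsum_nonneg fun n => by positivity) zero_le_two
  refine ⟨C * Δ ^ 2 + C / Δ ^ 2 + C ^ 2, fun t ⟨ht, ht1⟩ => ?_⟩
  have ha : 0 < t * Δ := by positivity
  have hb : 0 < t / Δ := by positivity
  rw [mul_assoc, mul_div_assoc, theta3_exp_inv ha, theta3_exp_inv hb]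
  have hu := abs_theta3_exp_sub_one_le (inv_pos.mpr ha)
  have hv := abs_theta3_exp_sub_one_le (inv_pos.mpr hb)
  set u := theta3 (Real.exp (-(Real.pi * (t * Δ)⁻¹))) - 1 with hu_def
  set v := theta3 (Real.exp (-(Real.pi * (t / Δ)⁻¹))) - 1 with hv_def
  have hsqrt : Real.sqrt (t * Δ) * Real.sqrt (t / Δ) = t := by
    rw [← Real.sqrt_mul ha.le, show t * Δ * (t / Δ) = t ^ 2 by field_simp, Real.sqrt_sq ht.le]
  have hu' : |u| ≤ C * Δ ^ 2 * t ^ 2 := hu.trans_eq (by simp only [C]; field_simp)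
  have hv' : |v| ≤ C / Δ ^ 2 * t ^ 2 := hv.trans_eq (by simp only [C]; field_simp)
  have huv : |u * v| ≤ C ^ 2 * t ^ 2 := by
    rw [abs_mul]
    calc |u| * |v| ≤ (C * Δ ^ 2 * t ^ 2) * (C / Δ ^ 2 * t ^ 2) := by gcongr
      _ = C ^ 2 * t ^ 2 * t ^ 2 := by field_simp
      _ ≤ C ^ 2 * t ^ 2 * 1 := by gcongr; exact pow_le_one₀ ht.le ht1.le
      _ = C ^ 2 * t ^ 2 := mul_one _
  have heq : 1 / Real.sqrt (t * Δ) * theta3 (Real.exp (-(Real.pi * (t * Δ)⁻¹))) *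
      (1 / Real.sqrt (t / Δ) * theta3 (Real.exp (-(Real.pi * (t / Δ)⁻¹)))) - 1 / t
      = (u + v + u * v) / t := by
    have h1 : theta3 (Real.exp (-(Real.pi * (t * Δ)⁻¹))) = 1 + u := by rw [hu_def]; ring
    have h2 : theta3 (Real.exp (-(Real.pi * (t / Δ)⁻¹))) = 1 + v := by rw [hv_def]; ring
    rw [h1, h2, mul_mul_mul_comm, one_div_mul_one_div, hsqrt]
    ring
  rw [heq, abs_div, abs_of_pos ht, div_le_iff₀ ht]
  have := abs_add_three u v (u * v)
  linarith

/-- The integral in the definition of `F` is bounded for `s` near `0`. -/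
theorem exists_norm_integral_theta3_le {Δ : ℝ} (hΔ : 0 < Δ) :
    ∃ K : ℝ, ∀ s : ℂ, |s.re| ≤ 1 / 2 →
      ‖∫ t in Set.Ioo (0 : ℝ) 1, ((t : ℂ) ^ (s - 1) + (t : ℂ) ^ (-s)) *
        ((theta3 (Real.exp (-(Real.pi * t * Δ))) *
            theta3 (Real.exp (-(Real.pi * t / Δ))) - 1 / t : ℝ) : ℂ)‖ ≤ K := by
  obtain ⟨K, hK⟩ := exists_abs_theta3_mul_theta3_sub_le hΔ
  refine ⟨∫ t in Set.Ioo (0 : ℝ) 1, 2 * K * t ^ (-1 / 2 : ℝ), fun s hs => ?_⟩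
  obtain ⟨hs1, hs2⟩ := abs_le.mp hs
  refine norm_integral_le_of_norm_le ?_ ?_
  · exact ((intervalIntegral.integrableOn_Ioo_rpow_iff one_pos).mpr (by norm_num)).const_mul _
  · filter_upwards [ae_restrict_mem measurableSet_Ioo] with t ht
    have ht0 := ht.1
    have hpow (z : ℂ) (hz : -3 / 2 ≤ z.re) : ‖(t : ℂ) ^ z‖ ≤ t ^ (-3 / 2 : ℝ) := by
      rw [Complex.norm_cpow_eq_rpow_re_of_pos ht0]
      exact Real.rpow_le_rpow_of_exponent_ge ht0 ht.2.le hz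
    have hsum : ‖(t : ℂ) ^ (s - 1) + (t : ℂ) ^ (-s)‖ ≤ 2 * t ^ (-3 / 2 : ℝ) := by
      have h1 := hpow (s - 1) (by simp; linarith)
      have h2 := hpow (-s) (by simp; linarith)
      linarith [norm_add_le ((t : ℂ) ^ (s - 1)) ((t : ℂ) ^ (-s))]
    rw [norm_mul, Complex.norm_real, Real.norm_eq_abs]
    calc _ ≤ 2 * t ^ (-3 / 2 : ℝ) * (K * t) := by gcongr; exact hK t ht
      _ = 2 * K * (t ^ (-3 / 2 : ℝ) * t) := by ring
      _ = 2 * K * t ^ (-1 / 2 : ℝ) := by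
        rw [← Real.rpow_add_one ht0.ne']; norm_num

/-- for every `Δ > 0`, the analytic continuation of the Epstein zeta
function takes the value `-1/2` at `s = 0`; precisely,
`lim_{s→0, s≠0} s · (π/Δ)^s · F(s,Δ) = -1/2`. -/
theorem epstein_value_at_zero (Δ : ℝ) (hΔ : 0 < Δ) :
    Filter.Tendsto (fun s : ℂ => s * ((Real.pi / Δ : ℝ) : ℂ) ^ s * F s Δ)
      (nhdsWithin 0 {(0 : ℂ)}ᶜ) (nhds (-1 / 2)) := by
  obtain ⟨K, hK⟩ := exists_norm_integral_theta3_le hΔ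
  have hre : ∀ᶠ s : ℂ in nhdsWithin 0 {(0 : ℂ)}ᶜ, |s.re| ≤ 1 / 2 := by
    filter_upwards [mem_nhdsWithin_of_mem_nhds (Metric.ball_mem_nhds (0 : ℂ) one_half_pos)]
      with s hs
    exact (Complex.abs_re_le_norm s).trans (mem_ball_zero_iff.mp hs).le
  have hI := tendsto_self_mul_of_norm_le (hre.mono hK)
  have hc : ((Real.pi / Δ : ℝ) : ℂ) ≠ 0 :=
    Complex.ofReal_ne_zero.mpr (div_pos Real.pi_pos hΔ).ne'
  have hpow : Filter.Tendsto (fun s : ℂ => ((Real.pi / Δ : ℝ) : ℂ) ^ s)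
      (nhdsWithin 0 {(0 : ℂ)}ᶜ) (nhds 1) := by
    have h := (continuousAt_const_cpow hc (b := 0)).tendsto
    rw [Complex.cpow_zero] at h
    exact h.mono_left nhdsWithin_le_nhds
  have hpole : Filter.Tendsto (fun s : ℂ => -(1 / 2) * (s / (1 - s) + 1))
      (nhdsWithin 0 {(0 : ℂ)}ᶜ) (nhds (-(1 / 2))) := by
    have h : ContinuousAt (fun s : ℂ => -(1 / 2) * (s / (1 - s) + 1)) 0 := by
      fun_prop (disch := simp)
    simpa using h.tendsto.mono_left nhdsWithin_le_nhds
  have hlim := hpow.mul (hpole.add (hI.const_mul (1 / 2)))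
  rw [show (1 : ℂ) * (-(1 / 2) + 1 / 2 * 0) = -1 / 2 by norm_num] at hlim
  refine hlim.congr' ?_
  filter_upwards [self_mem_nhdsWithin] with s hs
  have hs0 : s ≠ 0 := hs
  rw [F]
  field_simp
end

section
/- For every complex s with Re(s) > 1, there exists a constant C > 0 (depending only on s) such that for all real Δ with 0 < Δ ≤ 1, |ζ⁽²⁾(s,Δ) − Δ^{−2s} ζ(2s) − Δ^{−1} √π (Γ(s−1/2)/Γ(s)) ζ(2s−1)| ≤ C; that is, ζ⁽²⁾(s,Δ) = Δ^{−2s} ζ(2s) + Δ^{−1} √π (Γ(s−1/2)/Γ(s)) ζ(2s−1) + O(1) uniformly as Δ → 0⁺. -/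
open MeasureTheory

theorem norm_cpow_neg_sub_cpow_neg_le {s : ℂ} (hs : 0 < s.re) {a b : ℝ} (ha : 0 < a)
    (hab : a ≤ b) :
    ‖(a : ℂ) ^ (-s) - (b : ℂ) ^ (-s)‖ ≤ ‖s‖ / s.re * (a ^ (-s.re) - b ^ (-s.re)) := by
  have h0 : (0 : ℝ) ∉ Set.uIcc a b := by
    rw [Set.uIcc_of_le hab]; exact fun h => absurd h.1 (not_le.2 ha)
  have hs0 : s ≠ 0 := fun h => by simp [h] at hs
  have h1 : (a : ℂ) ^ (-s) - (b : ℂ) ^ (-s) = s * ∫ x : ℝ in a..b, (x : ℂ) ^ (-s - 1) := by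
    rw [integral_cpow (Or.inr ⟨by simpa [sub_eq_iff_eq_add] using hs0, h0⟩)]
    simp only [sub_add_cancel]
    field_simp
    ring
  have h2 : a ^ (-s.re) - b ^ (-s.re) = s.re * ∫ x : ℝ in a..b, x ^ (-s.re - 1) := by
    rw [integral_rpow (Or.inr ⟨by simpa [sub_eq_iff_eq_add] using hs.ne', h0⟩)]
    simp only [sub_add_cancel]
    field_simp
    ring
  rw [h1, h2, norm_mul, ← mul_assoc, div_mul_cancel₀ _ hs.ne']
  gcongr
  refine intervalIntegral.norm_integral_le_of_norm_le hab ?_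
    (intervalIntegral.intervalIntegrable_rpow (Or.inr h0))
  refine Filter.Eventually.of_forall fun x hx => ?_
  rw [Complex.norm_cpow_eq_rpow_re_of_pos (ha.trans hx.1)]
  simp

theorem norm_tsum_sub_integral_Ioi_le {f : ℝ → ℂ} {h : ℝ → ℝ} (hf : Continuous f)
    (hfi : IntegrableOn f (Set.Ioi 0)) (hsum : Summable fun n : ℕ => f n)
    (h_nonneg : ∀ x, 0 ≤ h x)
    (hle : ∀ x y, 0 ≤ x → x ≤ y → ‖f x - f y‖ ≤ h x - h y) :
    ‖∑' n : ℕ, f n - ∫ x in Set.Ioi (0 : ℝ), f x‖ ≤ h 0 := by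
  have hlim : Filter.Tendsto
      (fun N : ℕ => ‖∑ n ∈ Finset.range N, f n - ∫ x in (0 : ℝ)..N, f x‖) Filter.atTop
      (nhds ‖∑' n : ℕ, f n - ∫ x in Set.Ioi (0 : ℝ), f x‖) :=
    (hsum.hasSum.tendsto_sum_nat.sub
      (intervalIntegral_tendsto_integral_Ioi 0 hfi tendsto_natCast_atTop_atTop)).norm
  refine le_of_tendsto hlim (Filter.Eventually.of_forall fun N => ?_)
  have hstep : ∀ n : ℕ, ‖f n - ∫ x in (n : ℝ)..(n + 1 : ℕ), f x‖ ≤ h n - h (n + 1 : ℕ) := by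
    intro n
    have hn : ((n : ℝ)) ≤ ((n + 1 : ℕ) : ℝ) := by push_cast; linarith
    have : f n - ∫ x in (n : ℝ)..(n + 1 : ℕ), f x
        = ∫ x in (n : ℝ)..(n + 1 : ℕ), (f n - f x) := by
      rw [intervalIntegral.integral_sub (by simp) (hf.intervalIntegrable _ _)]
      simp
    rw [this]
    refine (intervalIntegral.norm_integral_le_of_norm_le_const
      (C := h n - h (n + 1 : ℕ)) fun x hx => ?_).trans (by simp)
    rw [Set.uIoc_of_le hn] at hx
    have h1 := hle n x (by positivity) hx.1.le
    have h2 := (norm_nonneg _).trans (hle x (n + 1 : ℕ) (n.cast_nonneg.trans hx.1.le) hx.2)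
    linarith
  have hsplit : ∫ x in (0 : ℝ)..N, f x
      = ∑ n ∈ Finset.range N, ∫ x in (n : ℝ)..(n + 1 : ℕ), f x := by
    rw [intervalIntegral.sum_integral_adjacent_intervals (a := fun n : ℕ => (n : ℝ))
      fun k _ => hf.intervalIntegrable _ _]
    simp
  rw [hsplit, ← Finset.sum_sub_distrib]
  refine (norm_sum_le_of_le _ fun n _ => hstep n).trans ?_
  rw [Finset.sum_range_sub' (fun n : ℕ => h n)]
  simpa using h_nonneg N

theorem integrable_one_add_sq_cpow_neg {s : ℂ} (hs : 1 / 2 < s.re) :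
    Integrable fun u : ℝ => ((1 + u ^ 2 : ℝ) : ℂ) ^ (-s) := by
  have h := integrable_rpow_neg_one_add_norm_sq (E := ℝ) (μ := volume) (r := 2 * s.re)
    (by simp; linarith)
  refine h.mono' (Measurable.aestronglyMeasurable (by fun_prop))
    (Filter.Eventually.of_forall fun u => ?_)
  rw [Complex.norm_cpow_eq_rpow_re_of_pos (by positivity)]
  simp [neg_div]

theorem integral_Ioi_one_add_sq_cpow_neg {s : ℂ} (hs : 1 / 2 < s.re) :
    ∫ u in Set.Ioi (0 : ℝ), ((1 + u ^ 2 : ℝ) : ℂ) ^ (-s) =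
      1 / 2 * (((Real.sqrt Real.pi : ℝ) : ℂ) *
        (Complex.Gamma (s - 1 / 2) / Complex.Gamma s)) := by
  have hB := Complex.betaIntegral_eq_Gamma_mul_div (1 / 2) (s - 1 / 2) (by norm_num)
    (by simpa using hs)
  rw [Complex.Gamma_one_half_eq, add_sub_cancel] at hB
  have hpi : ((Real.sqrt Real.pi : ℝ) : ℂ) = (Real.pi : ℂ) ^ (1 / 2 : ℂ) := by
    rw [Real.sqrt_eq_rpow, Complex.ofReal_cpow Real.pi_pos.le]
    simp
  rw [hpi, ← mul_div_assoc, ← hB, Complex.betaIntegral,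
    intervalIntegral.integral_of_le zero_le_one, integral_Ioc_eq_integral_Ioo]
  set φ : ℝ → ℝ := fun u => 1 - (1 + u ^ 2)⁻¹ with hφ
  have himg : φ '' Set.Ioi 0 = Set.Ioo 0 1 := by
    ext x
    constructor
    · rintro ⟨u, hu, rfl⟩
      have hu : 0 < u := hu
      have : (1 + u ^ 2)⁻¹ < 1 := inv_lt_one_of_one_lt₀ (by nlinarith)
      have : 0 < (1 + u ^ 2)⁻¹ := by positivity
      constructor <;> simp only [hφ] <;> linarith
    · rintro ⟨h0, h1⟩
      have h1' : 0 < 1 - x := by linarith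
      refine ⟨Real.sqrt (x / (1 - x)), Real.sqrt_pos.2 (by positivity), ?_⟩
      simp only [hφ]
      rw [Real.sq_sqrt (by positivity)]
      field_simp
      ring
  have hinj : Set.InjOn φ (Set.Ioi 0) := by
    intro u hu v hv huv
    have hu : 0 < u := hu
    have hv : 0 < v := hv
    have : 1 + u ^ 2 = 1 + v ^ 2 := inv_injective (by simpa [hφ] using huv)
    exact (sq_eq_sq₀ hu.le hv.le).1 (by linarith)
  have hder : ∀ u ∈ Set.Ioi (0 : ℝ),
      HasDerivWithinAt φ (2 * u / (1 + u ^ 2) ^ 2) (Set.Ioi 0) u := by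
    intro u _
    have h := ((((hasDerivAt_id u).pow 2).const_add 1).inv
      (by positivity : (1 + id u ^ 2 : ℝ) ≠ 0)).const_sub 1
    refine (HasDerivAt.congr_deriv h ?_).hasDerivWithinAt
    simp [neg_div]
  rw [← himg, integral_image_eq_integral_abs_deriv_smul measurableSet_Ioi hder hinj,
    ← integral_const_mul]
  refine setIntegral_congr_fun measurableSet_Ioi fun u hu => ?_
  have hu : 0 < u := hu
  have hw : (0 : ℝ) < 1 + u ^ 2 := by positivity
  have hw' : ((1 + u ^ 2 : ℝ) : ℂ) ≠ 0 := by exact_mod_cast hw.ne'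
  have hu' : (u : ℂ) ≠ 0 := by exact_mod_cast hu.ne'
  have e1 : ((φ u : ℝ) : ℂ) = ((u ^ 2 : ℝ) : ℂ) / ((1 + u ^ 2 : ℝ) : ℂ) := by
    rw [← Complex.ofReal_div]
    congr 1
    simp only [hφ]
    field_simp
    ring
  have e2 : 1 - ((φ u : ℝ) : ℂ) = ((1 + u ^ 2 : ℝ) : ℂ)⁻¹ := by
    simp [hφ]
  have e3 : ((u ^ 2 : ℝ) : ℂ) ^ (-(1 / 2) : ℂ) = (u : ℂ)⁻¹ := by
    rw [show (-(1 / 2) : ℂ) = ((-(1 / 2) : ℝ) : ℂ) by simp, ← Complex.ofReal_cpow (by positivity),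
      ← Real.rpow_natCast, ← Real.rpow_mul hu.le]
    norm_num [Real.rpow_neg_one]
  rw [e2, e1, abs_of_pos (by positivity), show (1 / 2 - 1 : ℂ) = -(1 / 2) by norm_num,
    Complex.div_cpow_ofReal_nonneg (by positivity) hw.le, e3, Complex.inv_cpow _ _ (by
      rw [Complex.arg_ofReal_of_nonneg hw.le]; exact Real.pi_pos.ne), ← Complex.cpow_neg,
      Complex.real_smul]
  have e4 : ((1 + u ^ 2 : ℝ) : ℂ) ^ (-s) = ((1 + u ^ 2 : ℝ) : ℂ) ^ (1 / 2 : ℂ) *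
      ((1 + u ^ 2 : ℝ) : ℂ) ^ (-(s - 1 / 2 - 1)) * (((1 + u ^ 2 : ℝ) : ℂ) ^ 2)⁻¹ := by
    rw [← Complex.cpow_ofNat, ← Complex.cpow_neg, ← Complex.cpow_add _ _ hw',
      ← Complex.cpow_add _ _ hw']
    congr 1
    ring
  rw [e4, Complex.cpow_neg _ (1 / 2)]
  rw [Complex.ofReal_div, Complex.ofReal_mul, Complex.ofReal_pow]
  have : ((1 + u ^ 2 : ℝ) : ℂ) ^ (1 / 2 : ℂ) ≠ 0 := by
    simp [Complex.cpow_eq_zero_iff, hw', -Complex.ofReal_add]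
  field_simp
  rw [mul_comm, Complex.ofReal_ofNat]

theorem cpow_neg_sq_add_sq_eq (s : ℂ) {a Δ : ℝ} (ha : 0 < a) (x : ℝ) :
    ((a ^ 2 + Δ ^ 2 * x ^ 2 : ℝ) : ℂ) ^ (-s) =
      (a : ℂ) ^ (-(2 * s)) * ((1 + (Δ / a * x) ^ 2 : ℝ) : ℂ) ^ (-s) := by
  have h1 : a ^ 2 + Δ ^ 2 * x ^ 2 = a ^ 2 * (1 + (Δ / a * x) ^ 2) := by
    field_simp
  have h2 : ((a ^ 2 : ℝ) : ℂ) ^ (-s) = (a : ℂ) ^ (-(2 * s)) := by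
    rw [neg_mul_eq_mul_neg, Complex.cpow_ofNat_mul' (by
      rw [Complex.arg_ofReal_of_nonneg ha.le]; simp [Real.pi_pos]) (by
      rw [Complex.arg_ofReal_of_nonneg ha.le]; simp [Real.pi_pos.le])]
    simp
  rw [h1, Complex.ofReal_mul, Complex.mul_cpow_ofReal_nonneg (by positivity) (by positivity), h2]

theorem integrableOn_Ioi_sq_add_sq_cpow_neg {s : ℂ} (hs : 1 / 2 < s.re) {a Δ : ℝ} (ha : 0 < a)
    (hΔ : 0 < Δ) :
    IntegrableOn (fun x : ℝ => ((a ^ 2 + Δ ^ 2 * x ^ 2 : ℝ) : ℂ) ^ (-s)) (Set.Ioi 0) := by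
  simp_rw [cpow_neg_sq_add_sq_eq s ha]
  exact (((integrable_one_add_sq_cpow_neg hs).comp_mul_left'
    (div_pos hΔ ha).ne').const_mul _).integrableOn

theorem integral_Ioi_sq_add_sq_cpow_neg {s : ℂ} (hs : 1 / 2 < s.re) {a Δ : ℝ} (ha : 0 < a)
    (hΔ : 0 < Δ) :
    ∫ x in Set.Ioi (0 : ℝ), ((a ^ 2 + Δ ^ 2 * x ^ 2 : ℝ) : ℂ) ^ (-s) =
      1 / 2 * ((Δ : ℂ)⁻¹ * ((Real.sqrt Real.pi : ℝ) : ℂ) *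
        (Complex.Gamma (s - 1 / 2) / Complex.Gamma s) * (1 / (a : ℂ) ^ (2 * s - 1))) := by
  have ha' : (a : ℂ) ≠ 0 := by exact_mod_cast ha.ne'
  simp_rw [cpow_neg_sq_add_sq_eq s ha]
  rw [integral_const_mul, integral_comp_mul_left_Ioi (fun x : ℝ => ((1 + x ^ 2 : ℝ) : ℂ) ^ (-s)) 0
    (div_pos hΔ ha), mul_zero, integral_Ioi_one_add_sq_cpow_neg hs, Complex.real_smul,
    Complex.cpow_sub _ _ ha', Complex.cpow_neg, Complex.cpow_one]
  push_cast
  field_simp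

theorem norm_tsum_int_sq_add_sq_cpow_neg_sub_le {s : ℂ} (hs : 1 / 2 < s.re) {a Δ : ℝ} (ha : 0 < a) (hΔ : 0 < Δ)
    (hsum : Summable fun k : ℤ => ((a ^ 2 + Δ ^ 2 * (k : ℝ) ^ 2 : ℝ) : ℂ) ^ (-s)) :
    ‖∑' k : ℤ, ((a ^ 2 + Δ ^ 2 * (k : ℝ) ^ 2 : ℝ) : ℂ) ^ (-s) -
        (Δ : ℂ)⁻¹ * ((Real.sqrt Real.pi : ℝ) : ℂ) *
        (Complex.Gamma (s - 1 / 2) / Complex.Gamma s) * (1 / (a : ℂ) ^ (2 * s - 1))‖ ≤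
      (2 * (‖s‖ / s.re) + 1) * a ^ (-(2 * s.re)) := by
  have hs0 : 0 < s.re := by linarith
  set f : ℝ → ℂ := fun x => ((a ^ 2 + Δ ^ 2 * x ^ 2 : ℝ) : ℂ) ^ (-s) with hf
  have hpos : ∀ x : ℝ, 0 < a ^ 2 + Δ ^ 2 * x ^ 2 := fun x => by positivity
  have hsumN : Summable fun n : ℕ => f n := by
    simpa [hf, Function.comp_def] using hsum.comp_injective (Nat.cast_injective (R := ℤ))
  have hcont : Continuous f := by
    refine Continuous.cpow (by fun_prop) continuous_const fun x => ?_
    exact Complex.ofReal_mem_slitPlane.2 (hpos x)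
  have hbound := norm_tsum_sub_integral_Ioi_le hcont
    (integrableOn_Ioi_sq_add_sq_cpow_neg hs ha hΔ) hsumN
    (h := fun x => ‖s‖ / s.re * (a ^ 2 + Δ ^ 2 * x ^ 2) ^ (-s.re))
    (fun x => by positivity) (fun x y hx hxy => by
      rw [← mul_sub]
      exact norm_cpow_neg_sub_cpow_neg_le hs0 (hpos x) (by gcongr))
  have hapow : (a ^ 2) ^ (-s.re) = a ^ (-(2 * s.re)) := by
    rw [← Real.rpow_natCast, ← Real.rpow_mul ha.le]
    congr 1
    push_cast
    ring
  have hf0 : ‖f 0‖ = a ^ (-(2 * s.re)) := by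
    rw [hf, Complex.norm_cpow_eq_rpow_re_of_pos (hpos 0), ← hapow]
    simp
  have hZ : ∑' k : ℤ, f k = 2 * ∑' n : ℕ, f n - f 0 := by
    rw [tsum_int_eq_zero_add_two_mul_tsum_pnat (f := fun k : ℤ => f k) (fun k => by simp [hf]) hsum,
      hsumN.tsum_eq_zero_add]
    simp only [Int.cast_natCast, Int.cast_zero, Nat.cast_zero]
    rw [tsum_pnat_eq_tsum_succ (f := fun n : ℕ => f n), nsmul_eq_mul]
    push_cast
    ring
  have hI := integral_Ioi_sq_add_sq_cpow_neg hs ha hΔ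
  have hI' : (Δ : ℂ)⁻¹ * ((Real.sqrt Real.pi : ℝ) : ℂ) *
      (Complex.Gamma (s - 1 / 2) / Complex.Gamma s) * (1 / (a : ℂ) ^ (2 * s - 1)) =
      2 * ∫ x in Set.Ioi (0 : ℝ), f x := by
    rw [hI]; ring
  rw [hI']
  change ‖∑' k : ℤ, f k - _‖ ≤ _
  rw [hZ, show ∀ A B D : ℂ, 2 * A - D - 2 * B = 2 * (A - B) - D by intros; ring]
  refine (norm_sub_le _ _).trans ?_
  rw [norm_mul, hf0, Complex.norm_ofNat]
  simp only [ne_eq, OfNat.ofNat_ne_zero, not_false_eq_true, zero_pow, mul_zero, add_zero,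
    hapow] at hbound
  linarith

theorem summable_sq_add_sq_cpow_neg {s : ℂ} (hs : 1 < s.re) {Δ : ℝ} (hΔ : 0 < Δ) (hΔ1 : Δ ≤ 1) :
    Summable fun p : ℤ × ℤ =>
      (((p.1 : ℝ) ^ 2 + Δ ^ 2 * (p.2 : ℝ) ^ 2 : ℝ) : ℂ) ^ (-s) := by
  rw [← (finTwoArrowEquiv ℤ).summable_iff]
  refine Summable.of_norm_bounded
    ((EisensteinSeries.summable_one_div_norm_rpow (k := 2 * s.re) (by linarith)).mul_left
      ((Δ ^ 2) ^ (-s.re))) fun v => ?_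
  simp only [Function.comp_apply, finTwoArrowEquiv_apply]
  have hs0 : -s ≠ 0 := fun h => by simp [neg_eq_zero.1 h] at hs; linarith
  by_cases hv : v = 0
  · subst hv
    simp [Complex.zero_cpow hs0]
    positivity
  have hn : 0 < ‖v‖ := norm_pos_iff.2 hv
  have hle : Δ ^ 2 * ‖v‖ ^ 2 ≤ (v 0 : ℝ) ^ 2 + Δ ^ 2 * (v 1 : ℝ) ^ 2 := by
    have hD : Δ ^ 2 ≤ 1 := pow_le_one₀ hΔ.le hΔ1
    have h2 : ‖v‖ ^ 2 ≤ (v 0 : ℝ) ^ 2 + (v 1 : ℝ) ^ 2 := by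
      rw [EisensteinSeries.norm_eq_max_natAbs]
      rcases max_choice (v 0).natAbs (v 1).natAbs with h | h <;> rw [h, Nat.cast_natAbs] <;>
        simp <;> positivity
    nlinarith [sq_nonneg (v 0 : ℝ), sq_nonneg (v 1 : ℝ), sq_nonneg Δ]
  have hl : 0 < Δ ^ 2 * ‖v‖ ^ 2 := by positivity
  change ‖(((v 0 : ℝ) ^ 2 + Δ ^ 2 * (v 1 : ℝ) ^ 2 : ℝ) : ℂ) ^ (-s)‖ ≤ _
  rw [Complex.norm_cpow_eq_rpow_re_of_pos (hl.trans_le hle)]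
  refine (Real.rpow_le_rpow_of_nonpos hl hle (by simp; linarith)).trans (le_of_eq ?_)
  rw [Real.mul_rpow (by positivity) (by positivity), ← Real.rpow_natCast ‖v‖,
    ← Real.rpow_mul hn.le]
  congr 2
  simp

/-- for `Re s > 1` there is a constant `C > 0` (depending only on `s`)
such that for all `0 < Δ ≤ 1`,
`ζ⁽²⁾(s,Δ) = Δ^{-2s} ζ(2s) + Δ^{-1} √π (Γ(s-1/2)/Γ(s)) ζ(2s-1) + O(1)`
uniformly as `Δ → 0⁺`. -/
theorem epstein_small_Delta_expansion (s : ℂ) (hs : 1 < s.re) :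
    ∃ C : ℝ, 0 < C ∧ ∀ Δ : ℝ, 0 < Δ → Δ ≤ 1 →
      ‖epsteinZeta2 s Δ - (Δ : ℂ) ^ (-(2 * s)) * riemannZeta (2 * s) -
          (Δ : ℂ)⁻¹ * ((Real.sqrt Real.pi : ℝ) : ℂ) *
            (Complex.Gamma (s - 1 / 2) / Complex.Gamma s) *
            riemannZeta (2 * s - 1)‖ ≤ C := by
  have hσ : 0 < s.re := by linarith
  have hs0 : -s ≠ 0 := fun h => by simp [neg_eq_zero.1 h] at hs; linarith
  have hsumC : Summable fun n : ℕ => ((n + 1 : ℕ) : ℝ) ^ (-(2 * s.re)) :=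
    (summable_nat_add_iff 1).2 (Real.summable_nat_rpow.2 (by linarith))
  have hsumB := hsumC.mul_left (2 * (‖s‖ / s.re) + 1)
  refine ⟨∑' n : ℕ, (2 * (‖s‖ / s.re) + 1) * ((n + 1 : ℕ) : ℝ) ^ (-(2 * s.re)) + 1, ?_, ?_⟩
  · have : 0 ≤ ∑' n : ℕ, (2 * (‖s‖ / s.re) + 1) * ((n + 1 : ℕ) : ℝ) ^ (-(2 * s.re)) :=
      tsum_nonneg fun n => by positivity
    linarith
  intro Δ hΔ hΔ1
  have hF := summable_sq_add_sq_cpow_neg hs hΔ hΔ1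
  set F : ℤ × ℤ → ℂ := fun p => (((p.1 : ℝ) ^ 2 + Δ ^ 2 * (p.2 : ℝ) ^ 2 : ℝ) : ℂ) ^ (-s) with hFdef
  set R : ℤ → ℂ := fun j => ∑' k : ℤ, F (j, k) with hR
  have hRsum : Summable R := hF.prod
  have hF0 : F 0 = 0 := by simp [hFdef, hs0]
  have htot : epsteinZeta2 s Δ = 1 / 2 * ∑' j : ℤ, R j := by
    unfold epsteinZeta2
    rw [← hF.tsum_prod]
    congr 1
    refine tsum_subtype_eq_of_support_subset (f := F) (s := {p | p ≠ 0}) fun p hp h => ?_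
    exact hp (h ▸ hF0)
  have hRsplit : ∑' j : ℤ, R j = R 0 + 2 * ∑' n : ℕ, R (n + 1 : ℕ) := by
    rw [tsum_int_eq_zero_add_two_mul_tsum_pnat (fun j => by simp [hR, hFdef]) hRsum,
      tsum_pnat_eq_tsum_succ (f := fun n : ℕ => R n), nsmul_eq_mul]
    push_cast
    rfl
  have hR0 : R 0 = 2 * ((Δ : ℂ) ^ (-(2 * s)) * riemannZeta (2 * s)) := by
    have h0sum : Summable fun k : ℤ => F (0, k) :=
      hF.comp_injective (Prod.mk_right_injective 0)
    simp only [hR]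
    rw [tsum_int_eq_zero_add_two_mul_tsum_pnat (fun k => by simp [hFdef]) h0sum,
      tsum_pnat_eq_tsum_succ (f := fun n : ℕ => F (0, (n : ℤ))), nsmul_eq_mul,
      zeta_eq_tsum_one_div_nat_add_one_cpow (by simp; linarith),
      ← tsum_mul_left (a := (Δ : ℂ) ^ (-(2 * s)))]
    rw [show ((0 : ℤ), (0 : ℤ)) = 0 from rfl, hF0, zero_add]
    push_cast
    congr 1
    refine tsum_congr fun n => ?_
    have h := cpow_neg_sq_add_sq_eq s (a := Δ * (n + 1)) (Δ := 0) (by positivity) 0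
    have e : F (0, (n : ℤ) + 1) = (((Δ * (n + 1)) ^ 2 + 0 ^ 2 * 0 ^ 2 : ℝ) : ℂ) ^ (-s) := by
      simp only [hFdef]
      congr 2
      push_cast
      ring
    rw [e, h, Complex.ofReal_mul, Complex.mul_cpow_ofReal_nonneg hΔ.le (by positivity),
      Complex.cpow_neg (((n + 1 : ℝ)) : ℂ)]
    simp
  have hzsum : Summable fun n : ℕ => 1 / ((n : ℂ) + 1) ^ (2 * s - 1) := by
    have := (summable_nat_add_iff 1).2
      (Complex.summable_one_div_nat_cpow (p := 2 * s - 1).2 (by simp; linarith))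
    simpa using this
  have hRN : Summable fun n : ℕ => R (n + 1 : ℕ) :=
    hRsum.comp_injective (Nat.cast_injective.comp (add_left_injective 1))
  set c : ℂ := (Δ : ℂ)⁻¹ * ((Real.sqrt Real.pi : ℝ) : ℂ) *
    (Complex.Gamma (s - 1 / 2) / Complex.Gamma s) with hc
  have key : epsteinZeta2 s Δ - (Δ : ℂ) ^ (-(2 * s)) * riemannZeta (2 * s) -
      c * riemannZeta (2 * s - 1) =
      ∑' n : ℕ, (R (n + 1 : ℕ) - c * (1 / ((n : ℂ) + 1) ^ (2 * s - 1))) := by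
    rw [hRN.tsum_sub (hzsum.mul_left c), tsum_mul_left,
      ← zeta_eq_tsum_one_div_nat_add_one_cpow (by simp; linarith), htot, hRsplit, hR0]
    ring
  rw [key]
  refine (tsum_of_norm_bounded hsumB.hasSum fun n => ?_).trans (by linarith)
  have hn : (0 : ℝ) < ((n + 1 : ℕ) : ℝ) := by positivity
  have h := norm_tsum_int_sq_add_sq_cpow_neg_sub_le (s := s) (by linarith) hn hΔ
    (by simpa [hFdef, Function.comp_def] using
      hF.comp_injective (Prod.mk_right_injective ((n + 1 : ℕ) : ℤ)))
  simpa [hR, hFdef, hc] using h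
end

section
/- As real δ → 0 (δ ≠ 0), one has −Γ(−δ) ζ(−2δ) / (Γ(δ) ζ(2δ)) = 1 + 2(γ − 2 ln(2π)) δ + o(δ), where γ is the Euler–Mascheroni constant; that is, the function δ ↦ −Γ(−δ)ζ(−2δ)/(Γ(δ)ζ(2δ)), extended by the value 1 at δ = 0, is differentiable at 0 with derivative 2(γ − 2 ln(2π)). -/
/-- The quotient of reflected values `g (-s) / g s` has derivative `-2 g'/g` at `0`. -/
theorem HasDerivAt.comp_neg_div_self {g : ℂ → ℂ} {g' : ℂ} (hg : HasDerivAt g g' 0)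
    (h0 : g 0 ≠ 0) : HasDerivAt (fun s => g (-s) / g s) (-2 * (g' / g 0)) 0 := by
  have hneg : HasDerivAt (fun s => g (-s)) (-g') 0 := by
    have hg0 : HasDerivAt g g' (-0) := by simpa using hg
    exact (hg0.comp (0 : ℂ) (hasDerivAt_neg (0 : ℂ))).congr_deriv (mul_neg_one g')
  refine (hneg.div hg h0).congr_deriv ?_
  simp only [neg_zero]
  field_simp
  ring

theorem hasDerivAt_Gamma_one_add_mul_riemannZeta_two_mul :
    HasDerivAt (fun s : ℂ => Complex.Gamma (1 + s) * riemannZeta (2 * s))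
      ((Real.eulerMascheroniConstant - 2 * Real.log (2 * Real.pi) : ℝ) / 2 : ℂ) 0 := by
  have hΓ : HasDerivAt (fun s : ℂ => Complex.Gamma (1 + s))
      (-Real.eulerMascheroniConstant : ℂ) 0 := by
    have h : HasDerivAt Complex.Gamma (-Real.eulerMascheroniConstant : ℂ) (1 + 0) := by
      simpa using Complex.hasDerivAt_Gamma_one
    exact h.comp_const_add 1 0
  have hζ : HasDerivAt (fun s : ℂ => riemannZeta (2 * s))
      (-Real.log (2 * Real.pi) : ℂ) 0 := by
    have h : HasDerivAt riemannZeta (-Real.log (2 * Real.pi) / 2 : ℂ) (2 * 0) := by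
      have := (differentiableAt_riemannZeta (s := 0) zero_ne_one).hasDerivAt
      rw [deriv_riemannZeta_zero] at this
      rw [mul_zero, Complex.ofReal_log (by positivity)]
      simpa using this
    refine (h.comp (0 : ℂ) ((hasDerivAt_id (0 : ℂ)).const_mul 2)).congr_deriv ?_
    ring
  refine (hΓ.mul hζ).congr_deriv ?_
  simp only [mul_zero, add_zero, Complex.Gamma_one, riemannZeta_zero]
  push_cast
  ring


/-- the function `δ ↦ -Γ(-δ)ζ(-2δ)/(Γ(δ)ζ(2δ))`, extended by the
value `1` at `δ = 0`, is differentiable at `0` with derivative `2(γ - 2 ln(2π))`,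
where `γ` is the Euler–Mascheroni constant; i.e.
`-Γ(-δ)ζ(-2δ)/(Γ(δ)ζ(2δ)) = 1 + 2(γ - 2 ln(2π)) δ + o(δ)` as `δ → 0`. -/
theorem gamma_zeta_ratio_derivative :
    HasDerivAt (fun δ : ℝ =>
        if δ = 0 then (1 : ℂ)
        else -(Complex.Gamma (-(δ : ℂ)) * riemannZeta (-(2 * (δ : ℂ)))) /
          (Complex.Gamma (δ : ℂ) * riemannZeta (2 * (δ : ℂ))))
      ((2 * (Real.eulerMascheroniConstant - 2 * Real.log (2 * Real.pi)) : ℝ) : ℂ)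
      0 := by
  have h := (hasDerivAt_Gamma_one_add_mul_riemannZeta_two_mul.comp_neg_div_self
    (by simp [riemannZeta_zero])).comp_ofReal (z := 0)
  convert h using 1
  · funext δ
    split_ifs with hδ
    · simp [hδ, riemannZeta_zero]
    · have hδ' : (δ : ℂ) ≠ 0 := Complex.ofReal_ne_zero.mpr hδ
      have h1 := Complex.Gamma_add_one _ hδ'
      have h2 := Complex.Gamma_add_one _ (neg_ne_zero.mpr hδ')
      rw [add_comm 1 (-(δ : ℂ)), add_comm 1 (δ : ℂ), h1, h2, mul_neg, mul_assoc, mul_assoc,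
        neg_mul, ← mul_neg (δ : ℂ), mul_div_mul_left _ _ hδ']
  · simp only [mul_zero, add_zero, Complex.Gamma_one, riemannZeta_zero]
    push_cast
    ring
end
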